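/- arXiv:2603.28536 — 2 statements merged into one kernel-verified Lean document; each statement's English description precedes it below -/
import Mathlib

section
/- Let z₁, z₂ ∈ ℂ with Im(z₁) > 0 and Im(z₂) > 0, and let Λ₁ and Λ₂ be the additive subgroups of ℂ generated by {z₁, 1} and {z₂, 1} respectively. If Λ₁ ⊆ Λ₂, then Λ₁ has finite index in Λ₂ and this index, as a real number, equals Im(z₁)/Im(z₂); equivalently, Nat.card(Λ₂ / Λ₁) · Im(z₂) = Im(z₁). -/
/-- A multiple `m • z₂` lies in the lattice `ℤz₁ + ℤ`, where `z₁ = a • z₂ + b`, exactly when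
`a` divides `m`. -/
lemma comap_zmultiplesHom_closure_pair_one {z₁ z₂ : ℂ} (h₂ : z₂.im ≠ 0) {a b : ℤ}
    (hab : a • z₂ + b • (1 : ℂ) = z₁) :
    (AddSubgroup.closure {z₁, 1}).comap (zmultiplesHom ℂ z₂) = AddSubgroup.zmultiples a := by
  ext m
  simp only [AddSubgroup.mem_comap, zmultiplesHom_apply, AddSubgroup.mem_closure_pair,
    Int.mem_zmultiples_iff]
  constructor
  · rintro ⟨x, y, hxy⟩
    refine ⟨x, ?_⟩
    have him := congrArg Complex.im hxy
    simp [← hab] at him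
    have hm : (m : ℝ) = a * x := mul_right_cancel₀ h₂ (by linarith)
    exact_mod_cast hm
  · rintro ⟨x, rfl⟩
    refine ⟨x, -(x * b), ?_⟩
    simp [← hab]
    ring

/-- If `z₁ = a • z₂ + b`, then the index of `ℤz₁ + ℤ` in `ℤz₂ + ℤ` is `|a|`. -/
lemma relIndex_closure_pair_one {z₁ z₂ : ℂ} (h₂ : z₂.im ≠ 0) {a b : ℤ}
    (hab : a • z₂ + b • (1 : ℂ) = z₁)
    (hle : AddSubgroup.closure {z₁, 1} ≤ AddSubgroup.closure {z₂, 1}) :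
    (AddSubgroup.closure {z₁, 1}).relIndex (AddSubgroup.closure {z₂, 1}) = a.natAbs := by
  have hsup : AddSubgroup.closure {z₂, 1} =
      AddSubgroup.zmultiples z₂ ⊔ AddSubgroup.closure {z₁, 1} := by
    refine le_antisymm ((AddSubgroup.closure_le _).2 ?_) (sup_le ?_ hle)
    · rintro w (rfl | rfl)
      · exact AddSubgroup.mem_sup_left (AddSubgroup.mem_zmultiples w)
      · exact AddSubgroup.mem_sup_right (AddSubgroup.subset_closure (by simp))
    · exact AddSubgroup.zmultiples_le_of_mem (AddSubgroup.subset_closure (by simp))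
  have hrange : AddSubgroup.zmultiples z₂ = (⊤ : AddSubgroup ℤ).map (zmultiplesHom ℂ z₂) := by
    ext w
    simp [AddSubgroup.mem_zmultiples_iff]
  rw [hsup, AddSubgroup.relIndex_sup_right, hrange, ← AddSubgroup.relIndex_comap,
    AddSubgroup.relIndex_top_right, comap_zmultiplesHom_closure_pair_one h₂ hab,
    Int.index_zmultiples]


/-- If `Λ₁ = ℤz₁ + ℤ ⊆ Λ₂ = ℤz₂ + ℤ` with `Im z₁, Im z₂ > 0`, then `Λ₁` has finite
index in `Λ₂`, and this index equals `Im z₁ / Im z₂`. -/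
theorem lattice_index_eq_ratio_of_im
    (z₁ z₂ : ℂ) (h₁ : 0 < z₁.im) (h₂ : 0 < z₂.im)
    (Λ₁ Λ₂ : AddSubgroup ℂ)
    (hΛ₁ : Λ₁ = AddSubgroup.closure {z₁, 1})
    (hΛ₂ : Λ₂ = AddSubgroup.closure {z₂, 1})
    (hle : Λ₁ ≤ Λ₂) :
    0 < Nat.card (Λ₂ ⧸ Λ₁.addSubgroupOf Λ₂) ∧
      (Nat.card (Λ₂ ⧸ Λ₁.addSubgroupOf Λ₂) : ℝ) * z₂.im = z₁.im := by
  subst hΛ₁ hΛ₂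
  obtain ⟨a, b, hab⟩ :=
    AddSubgroup.mem_closure_pair.1 (hle (AddSubgroup.subset_closure (Set.mem_insert z₁ {1})))
  have him : (a : ℝ) * z₂.im = z₁.im := by simp [← hab]
  have ha : 0 < a := by
    have : (0 : ℝ) < a := pos_of_mul_pos_left (him ▸ h₁) h₂.le
    exact_mod_cast this
  have hcard := relIndex_closure_pair_one h₂.ne' hab hle
  rw [AddSubgroup.relIndex, AddSubgroup.index] at hcard
  rw [hcard]
  refine ⟨Int.natAbs_pos.2 ha.ne', ?_⟩
  rw [Nat.cast_natAbs, abs_of_pos ha, him]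
end

section
/- Let K be a number field with ring of integers 𝓞_K, let I be a nonzero ideal of 𝓞_K regarded as an 𝓞_K-module, let α ∈ I be nonzero, and let m ≥ 1 be an integer. Then the cardinality of the quotient of the m-th tensor power I^{⊗m} (tensor power over 𝓞_K) by the 𝓞_K-submodule generated by α^{⊗m} := α ⊗ ⋯ ⊗ α equals the m-th power of the cardinality of I/(𝓞_K·α); that is, #(I^{⊗m}/𝓞_K·α^{⊗m}) = #(I/𝓞_K·α)^m. -/
open scoped TensorProduct PiTensorProduct

/-- The tensor product of two ideals of a Dedekind domain is their product, via multiplication. -/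
theorem Ideal.exists_tensorProduct_equiv_mul {R : Type*} [CommRing R] [IsDedekindDomain R]
    (I J : Ideal R) :
    ∃ e : (I ⊗[R] J) ≃ₗ[R] (I * J : Ideal R), ∀ x y, (e (x ⊗ₜ y) : R) = x * y := by
  have hinj : Function.Injective (Submodule.mulMap' I J) := by
    have h : Function.Injective (I.subtype.rTensor J) :=
      Module.Flat.rTensor_preserves_injective_linearMap _ I.injective_subtype
    have hmul : Submodule.mulMap I J =
        J.subtype ∘ₗ (TensorProduct.lid R J).toLinearMap ∘ₗ I.subtype.rTensor J := by
      ext x y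
      simp [Submodule.mulMap_tmul]
    have hmulInj : Function.Injective (Submodule.mulMap I J) := by
      rw [hmul]
      exact J.injective_subtype.comp ((TensorProduct.lid R J).injective.comp h)
    intro a b hab
    exact hmulInj (congrArg Subtype.val hab)
  exact ⟨LinearEquiv.ofBijective _ ⟨hinj, Submodule.mulMap'_surjective I J⟩, fun x y => rfl⟩

/-- The `m`-th tensor power of an ideal of a Dedekind domain is its `m`-th power, by an isomorphism
sending `α ⊗ ⋯ ⊗ α` to `α ^ m`. -/
theorem Ideal.exists_tensorPower_equiv_pow {R : Type*} [CommRing R] [IsDedekindDomain R]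
    (I : Ideal R) (α : I) (m : ℕ) :
    ∃ e : (⨂[R]^m I) ≃ₗ[R] (I ^ m : Ideal R),
      (e (PiTensorProduct.tprod R fun _ => α) : R) = (α : R) ^ m := by
  induction m with
  | zero =>
    refine ⟨(PiTensorProduct.isEmptyEquiv (Fin 0)).trans
      (Submodule.topEquiv.symm.trans (LinearEquiv.ofEq _ _ ?_)), ?_⟩
    · simp [Ideal.one_eq_top]
    · simp
  | succ m ih =>
    obtain ⟨e, he⟩ := ih
    obtain ⟨e', he'⟩ := (I ^ m).exists_tensorProduct_equiv_mul I
    refine ⟨(TensorPower.mulEquiv (n := m) (m := 1)).symm.trans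
      ((TensorProduct.congr e (PiTensorProduct.subsingletonEquiv (0 : Fin 1))).trans
        (e'.trans (LinearEquiv.ofEq _ _ (pow_succ I m).symm))), ?_⟩
    have h : (TensorPower.mulEquiv (n := m) (m := 1)).symm
        (PiTensorProduct.tprod R fun _ => α) =
        PiTensorProduct.tprod R (fun _ => α) ⊗ₜ[R] PiTensorProduct.tprod R (fun _ => α) := by
      rw [LinearEquiv.symm_apply_eq, ← TensorPower.gMul_def, TensorPower.tprod_mul_tprod]
      congr 1
      ext i
      refine Fin.addCases (fun j => ?_) (fun j => ?_) i <;> simp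
    simp [h, he, he', pow_succ]

/-- The index of a principal ideal in an ideal containing its generator. -/
theorem Ideal.card_quotient_span_singleton_mul_absNorm {R : Type*} [CommRing R]
    [IsDedekindDomain R] [Module.Free ℤ R] (J : Ideal R) (β : J) :
    Nat.card (J ⧸ Submodule.span R {β}) * J.absNorm =
      (Ideal.span {(β : R)}).absNorm := by
  have hle : Ideal.span {(β : R)} ≤ J := by simp
  have h := Submodule.card_quotient_mul_card_quotient J (Ideal.span {(β : R)}) hle
  let f : J →ₗ[R] R ⧸ Ideal.span {(β : R)} := (Ideal.span {(β : R)}).mkQ ∘ₗ J.subtype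
  have hker : Submodule.span R {β} = LinearMap.ker f := by
    ext x
    simp [f, LinearMap.ker_comp, Submodule.mem_span_singleton, Subtype.ext_iff]
  have hrange : LinearMap.range f = Submodule.map (Ideal.span {(β : R)}).mkQ J := by
    simp [f, LinearMap.range_comp]
  have hcard : Nat.card (J ⧸ Submodule.span R {β}) =
      Nat.card (Submodule.map (Ideal.span {(β : R)}).mkQ J) :=
    Nat.card_congr ((Submodule.quotEquivOfEq _ _ hker).trans
      (f.quotKerEquivRange.trans (LinearEquiv.ofEq _ _ hrange))).toEquiv
  rw [hcard]
  exact h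

/-- For a nonzero ideal `I` of the ring of integers of a number field, a nonzero `α ∈ I`
and `m ≥ 1`, the cardinality of the quotient of the `m`-th tensor power `I^{⊗m}` by the
submodule generated by `α^{⊗m}` equals `#(I/𝓞_K·α)^m`. -/
theorem card_tensorPower_quotient_pow
    (K : Type*) [Field K] [NumberField K]
    (I : Ideal (NumberField.RingOfIntegers K)) (hI : I ≠ 0)
    (α : I) (hα : α ≠ 0) (m : ℕ) (hm : 1 ≤ m) :
    Nat.card
        ((⨂[NumberField.RingOfIntegers K]^m I) ⧸
          Submodule.span (NumberField.RingOfIntegers K)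
            {PiTensorProduct.tprod (NumberField.RingOfIntegers K) (fun _ : Fin m => α)}) =
      Nat.card (I ⧸ Submodule.span (NumberField.RingOfIntegers K) {α}) ^ m := by
  obtain ⟨e, he⟩ := I.exists_tensorPower_equiv_pow α m
  have hcard := Nat.card_congr (Submodule.Quotient.equiv
    (Submodule.span _ {PiTensorProduct.tprod _ (fun _ : Fin m => α)})
    (Submodule.span _ {e (PiTensorProduct.tprod _ fun _ => α)}) e
    (by simp [Submodule.map_span])).toEquiv
  have hI' : I.absNorm ≠ 0 := Ideal.absNorm_eq_zero_iff.not.mpr hI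
  apply Nat.eq_of_mul_eq_mul_right (pow_pos (Nat.pos_of_ne_zero hI') m)
  rw [hcard, ← map_pow, Ideal.card_quotient_span_singleton_mul_absNorm, he, map_pow, ← mul_pow,
    Ideal.card_quotient_span_singleton_mul_absNorm, ← Ideal.span_singleton_pow, map_pow]
end
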